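/- Suppose 1 ≤ s ≤ r. Let λ' be an integer with λ'·λ_{j_s} ≡ 1 (mod m), and suppose (a_0, …, a_{s−1}, a) is an arithmetic pure gap at (j_0, …, j_{s−1}, j_s) for some integer a with 1 ≤ a ≤ m−2. Then (a_0, …, a_{s−1}, a+1) is an arithmetic pure gap at (j_0, …, j_{s−1}, j_s) if and only if ∑_{i=0}^{s−1} ⌊(a_i − (a+1)·λ'·λ_{j_i})/m⌋ + ⌊((a+1) − (a+1)·λ'·λ_{j_s})/m⌋ + ∑_{i=s+1}^{r} ⌊(−(a+1)·λ'·λ_{j_i})/m⌋ ≤ −1. -/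

import Mathlib

open Finset

/-- Floor of the rational number `x / m`. -/
noncomputable def fdivq (m : ℕ) (x : ℤ) : ℤ := ⌊(x : ℚ) / (m : ℚ)⌋

/-- The quantity `∑_{i=0}^{n-1} ⌊(a_i + t·λ_{c i})/m⌋ + ∑_{w ∉ range c} ⌊t·λ_w/m⌋`. -/
noncomputable def gapSum (m r n : ℕ) (lam : Fin (r + 1) → ℤ)
    (c : Fin n → Fin (r + 1)) (a : Fin n → ℤ) (t : ℤ) : ℤ :=
  (∑ i : Fin n, fdivq m (a i + t * lam (c i))) +
    ∑ w ∈ Finset.univ \ Finset.image c Finset.univ, fdivq m (t * lam w)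

/-- `(a 0, …, a (n-1))` is an *arithmetic pure gap* at the (pairwise distinct) indices
`c 0, …, c (n-1)` of `{0,…,r}`: the entries are nonnegative and for every
`t ∈ {0,…,m-1}` exactly one of the two Bartoli–Quoos–Zini conditions holds. -/
noncomputable def IsArithPureGap (m r n : ℕ) (lam : Fin (r + 1) → ℤ)
    (c : Fin n → Fin (r + 1)) (a : Fin n → ℤ) : Prop :=
  (∀ i, 0 ≤ a i) ∧
    ∀ t : ℤ, 0 ≤ t → t ≤ (m : ℤ) - 1 →
      Xor' (gapSum m r n lam c a t < 0)
        (0 ≤ gapSum m r n lam c a t ∧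
          ∀ i : Fin n, fdivq m (a i + t * lam (c i)) = fdivq m (a i + t * lam (c i) - 1))

theorem fdivq_eq_ediv (m : ℕ) (x : ℤ) : fdivq m x = x / (m : ℤ) :=
  Rat.floor_intCast_div_natCast x m

theorem fdivq_add_mul {m : ℕ} (hm : 0 < m) (x k : ℤ) :
    fdivq m (x + m * k) = fdivq m x + k := by
  rw [fdivq_eq_ediv, fdivq_eq_ediv, Int.add_mul_ediv_left _ _ (by omega)]

theorem fdivq_eq_fdivq_sub_one_iff {m : ℕ} (hm : 0 < m) (x : ℤ) :
    fdivq m x = fdivq m (x - 1) ↔ ¬ (m : ℤ) ∣ x := by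
  have hm' : (0 : ℤ) < m := by exact_mod_cast hm
  rw [fdivq_eq_ediv, fdivq_eq_ediv]
  constructor
  · rintro h ⟨k, rfl⟩
    rw [Int.mul_ediv_cancel_left _ hm'.ne'] at h
    have := Int.lt_ediv_add_one_mul_self (m * k - 1) hm'
    have hle := Int.ediv_mul_le (m * k - 1) hm'.ne'
    rw [← h] at hle
    linarith [mul_comm k (m : ℤ)]
  · intro h
    have hpos : 0 < x % m := Int.emod_pos_of_not_dvd h |>.resolve_left hm'.ne'
    have hlt := Int.emod_lt_of_pos x hm'
    have hx := Int.mul_ediv_add_emod x m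
    symm
    rw [Int.ediv_eq_iff_of_pos hm']
    constructor <;> linarith [mul_comm (x / (m : ℤ)) (m : ℤ)]

theorem gapSum_add_mul {m r n : ℕ} (hm : 0 < m) {lam : Fin (r + 1) → ℤ}
    (hsum : ∑ i, lam i = 0) {c : Fin n → Fin (r + 1)} (hc : Function.Injective c)
    (a : Fin n → ℤ) (t k : ℤ) :
    gapSum m r n lam c a (t + m * k) = gapSum m r n lam c a t := by
  have h1 (i : Fin n) : fdivq m (a i + (t + m * k) * lam (c i)) =
      fdivq m (a i + t * lam (c i)) + k * lam (c i) := by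
    rw [← fdivq_add_mul hm]; ring_nf
  have h2 (w : Fin (r + 1)) : fdivq m ((t + m * k) * lam w) =
      fdivq m (t * lam w) + k * lam w := by
    rw [← fdivq_add_mul hm]; ring_nf
  have h3 : ∑ i, lam (c i) + ∑ w ∈ univ \ image c univ, lam w = 0 := by
    rw [← hsum, ← sum_sdiff (subset_univ (image c univ)),
      sum_image fun _ _ _ _ h => hc h, add_comm]
  simp only [gapSum, h1, h2, sum_add_distrib, ← mul_sum]
  linear_combination k * h3

/-- A tuple is an arithmetic pure gap iff it is nonnegative and the sum of floors is negative at
every integer `t` for which some `a i + t * lam (c i)` is divisible by `m`. -/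
theorem isArithPureGap_iff {m r n : ℕ} (hm : 0 < m) {lam : Fin (r + 1) → ℤ}
    (hsum : ∑ i, lam i = 0) {c : Fin n → Fin (r + 1)} (hc : Function.Injective c)
    (a : Fin n → ℤ) :
    IsArithPureGap m r n lam c a ↔
      (∀ i, 0 ≤ a i) ∧
        ∀ t i, (m : ℤ) ∣ a i + t * lam (c i) → gapSum m r n lam c a t < 0 := by
  have hm' : (0 : ℤ) < m := by exact_mod_cast hm
  unfold IsArithPureGap
  refine and_congr_right fun _ => ?_
  simp only [fdivq_eq_fdivq_sub_one_iff hm]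
  constructor
  · intro h t i hd
    have ht : t % m + m * (t / m) = t := Int.emod_add_mul_ediv t m
    rcases h (t % m) (Int.emod_nonneg _ hm'.ne')
      (by linarith [Int.emod_lt_of_pos t hm']) with h | h
    · rw [← ht, gapSum_add_mul hm hsum hc]
      exact h.1
    · refine absurd ?_ (h.1.2 i)
      have : a i + t % m * lam (c i) = a i + t * lam (c i) - m * (t / m * lam (c i)) := by
        linear_combination lam (c i) * ht
      rw [this]
      exact dvd_sub hd (dvd_mul_right _ _)
  · intro h t _ _
    by_cases hg : gapSum m r n lam c a t < 0
    · exact Or.inl ⟨hg, fun h' => absurd hg h'.1.not_gt⟩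
    · exact Or.inr ⟨⟨not_lt.mp hg, fun i hd => hg (h t i hd)⟩, hg⟩

/-- Incrementing the last coordinate of a pure gap
(second part of Theorem find_another_pure_gap). -/
theorem snoc_succ_pureGap_iff (m r : ℕ) (hm : 2 ≤ m) (hr : 1 ≤ r)
    (lam : Fin (r + 1) → ℤ) (hlam : ∀ i, lam i ≠ 0) (hsum : ∑ i, lam i = 0)
    (s : ℕ) (hs1 : 1 ≤ s) (hsr : s ≤ r) (perm : Equiv.Perm (Fin (r + 1)))
    (c : Fin (s + 1) → Fin (r + 1))
    (hc : ∀ i, c i = perm (Fin.castLE (Nat.succ_le_succ hsr) i))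
    (cs : Fin s → Fin (r + 1)) (hcs : ∀ i, cs i = c i.castSucc)
    (hgcd : ∀ i, Int.gcd (m : ℤ) (lam (c i)) = 1)
    (lam' : ℤ) (hinv : Int.ModEq (m : ℤ) (lam' * lam (c (Fin.last s))) 1)
    (a₀ : Fin s → ℤ) (a : ℤ) (ha1 : 1 ≤ a) (ha2 : a ≤ (m : ℤ) - 2)
    (hpure : IsArithPureGap m r (s + 1) lam c (Fin.snoc a₀ a)) :
    IsArithPureGap m r (s + 1) lam c (Fin.snoc a₀ (a + 1)) ↔
      (∑ i : Fin s, fdivq m (a₀ i - (a + 1) * lam' * lam (cs i))) +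
          fdivq m ((a + 1) - (a + 1) * lam' * lam (c (Fin.last s))) +
          (∑ w ∈ Finset.univ \ Finset.image c Finset.univ,
            fdivq m (-((a + 1) * lam') * lam w)) ≤ -1 := by
  have hm0 : 0 < m := by omega
  have hinj : Function.Injective c := by
    intro i j hij
    rw [hc, hc] at hij
    exact Fin.castLE_injective _ (perm.injective hij)
  rw [isArithPureGap_iff hm0 hsum hinj] at hpure ⊢
  obtain ⟨hnonneg, hneg⟩ := hpure
  obtain ⟨k, hk⟩ := hinv.dvd
  set L := lam (c (Fin.last s)) with hL
  have hrhs : (∑ i : Fin s, fdivq m (a₀ i - (a + 1) * lam' * lam (cs i))) +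
      fdivq m ((a + 1) - (a + 1) * lam' * L) +
      (∑ w ∈ univ \ image c univ, fdivq m (-((a + 1) * lam') * lam w)) =
      gapSum m r (s + 1) lam c (Fin.snoc a₀ (a + 1)) (-((a + 1) * lam')) := by
    simp only [gapSum, Fin.sum_univ_castSucc, Fin.snoc_castSucc, Fin.snoc_last, hcs, neg_mul,
      sub_eq_add_neg, hL]
  rw [hrhs, Int.le_iff_lt_add_one, neg_add_cancel]
  constructor
  · rintro ⟨-, h⟩
    refine h _ (Fin.last s) ⟨(a + 1) * k, ?_⟩
    rw [Fin.snoc_last]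
    linear_combination (a + 1) * hk
  · intro h
    refine ⟨fun i => ?_, fun t i hd => ?_⟩
    · induction i using Fin.lastCases with
      | last => rw [Fin.snoc_last]; omega
      | cast i => simpa only [Fin.snoc_castSucc] using hnonneg i.castSucc
    · by_cases ht : (m : ℤ) ∣ a + 1 + t * L
      · obtain ⟨q, hq⟩ := ht
        have : t = -((a + 1) * lam') + m * (lam' * q + t * k) := by
          linear_combination t * hk + lam' * hq
        rw [this, gapSum_add_mul hm0 hsum hinj]
        exact h
      · have hfl := (fdivq_eq_fdivq_sub_one_iff hm0 _).mpr ht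
        rw [show a + 1 + t * L - 1 = a + t * L by ring] at hfl
        have hg : gapSum m r (s + 1) lam c (Fin.snoc a₀ (a + 1)) t =
            gapSum m r (s + 1) lam c (Fin.snoc a₀ a) t := by
          simp only [gapSum, Fin.sum_univ_castSucc, Fin.snoc_castSucc, Fin.snoc_last, ← hL, hfl]
        rw [hg]
        induction i using Fin.lastCases with
        | last => exact absurd (by simpa only [Fin.snoc_last] using hd) ht
        | cast i => exact hneg t i.castSucc (by simpa only [Fin.snoc_castSucc] using hd)
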